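/- arXiv:2302.14066 — 2 statements merged into one kernel-verified Lean document; each statement's English description precedes it below -/
import Mathlib

section
/- For all real constants c > 0 and c′ with 0 < c′ ≤ 100, there exists a real constant c″ > 0 (depending only on c and c′) such that: for all natural numbers Q ≥ 1 and d with d ≥ 100/c′, and every real N ≥ exp(c′·d²), if (1/N) · C(Q + d² − 1, Q) ≥ exp(−c·Q), then Q ≥ c″·d². -/
/-- The bound `C(n, k) ≤ (1 + x)ⁿ / xᵏ`, relaxed to exponential form. -/
theorem choose_le_exp_mul_sub_mul_log {x : ℝ} (hx : 0 < x) (n k : ℕ) :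
    (n.choose k : ℝ) ≤ Real.exp (x * n - k * Real.log x) := by
  rcases lt_or_ge n k with hnk | hkn
  · rw [Nat.choose_eq_zero_of_lt hnk, Nat.cast_zero]
    positivity
  have hterm : x ^ k * (n.choose k : ℝ) ≤ (x + 1) ^ n := by
    rw [add_pow]
    simpa using Finset.single_le_sum (s := Finset.range (n + 1))
      (f := fun i ↦ x ^ i * 1 ^ (n - i) * (n.choose i : ℝ))
      (fun i _ ↦ by positivity) (Finset.mem_range.2 (Nat.lt_succ_of_le hkn))
  have hexp : (x + 1) ^ n ≤ Real.exp (x * n) := by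
    rw [mul_comm, Real.exp_nat_mul]
    exact pow_le_pow_left₀ (by positivity) (Real.add_one_le_exp x) n
  rw [Real.exp_sub, Real.exp_nat_mul, Real.exp_log hx, le_div_iff₀ (by positivity), mul_comm]
  exact hterm.trans hexp

/-- For all constants `c > 0` and `0 < c′ ≤ 100` there is a constant
`c″ > 0` such that for all naturals `Q ≥ 1` and `d ≥ 100/c′` and every real
`N ≥ exp(c′·d²)`: if `(1/N)·C(Q + d² − 1, Q) ≥ exp(−c·Q)` then `Q ≥ c″·d²`. -/
theorem binom_lower_bound (c c' : ℝ) (hc : 0 < c) (hc' : 0 < c') (hc'100 : c' ≤ 100) :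
    ∃ c'' : ℝ, 0 < c'' ∧
      ∀ Q d : ℕ, 1 ≤ Q → 100 / c' ≤ (d : ℝ) →
        ∀ N : ℝ, Real.exp (c' * (d : ℝ) ^ 2) ≤ N →
          Real.exp (-c * (Q : ℝ)) ≤ (1 / N) * ((Q + d ^ 2 - 1).choose Q : ℝ) →
          c'' * (d : ℝ) ^ 2 ≤ (Q : ℝ) := by
  set x := c' / 2 with hxdef
  have hx : 0 < x := by positivity
  have hK : 0 < c + x + |Real.log x| := by positivity
  refine ⟨x / (c + x + |Real.log x|), by positivity, fun Q d _ _ N hN h ↦ ?_⟩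
  have hN0 : 0 < N := (Real.exp_pos _).trans_le hN
  rw [one_div, le_inv_mul_iff₀ hN0] at h
  have hchain : Real.exp (c' * (d : ℝ) ^ 2 + -c * Q) ≤
      Real.exp (x * (Q + d ^ 2 - 1 : ℕ) - Q * Real.log x) := by
    rw [Real.exp_add]
    exact (mul_le_mul_of_nonneg_right hN (Real.exp_pos _).le).trans
      (h.trans (choose_le_exp_mul_sub_mul_log hx _ _))
  rw [Real.exp_le_exp] at hchain
  have hn : ((Q + d ^ 2 - 1 : ℕ) : ℝ) ≤ Q + (d : ℝ) ^ 2 := by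
    exact_mod_cast Nat.sub_le (Q + d ^ 2) 1
  have hxn := mul_le_mul_of_nonneg_left hn hx.le
  have hlog := mul_le_mul_of_nonneg_left (neg_abs_le (Real.log x)) (Nat.cast_nonneg (α := ℝ) Q)
  have hc'x : c' = 2 * x := by rw [hxdef]; ring
  rw [hc'x] at hchain
  rw [div_mul_eq_mul_div, div_le_iff₀ hK]
  linarith
end

section
/- For all natural numbers d ≥ 1 and Q: the sum, over all Young diagrams μ with exactly Q boxes and at most d rows, of the square of the number of semistandard Young tableaux of shape μ with entries in {0, 1, …, d−1}, equals the binomial coefficient C(Q + d² − 1, Q). -/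
namespace Nat

theorem sum_antidiagonal_multichoose (b k : ℕ) :
    ∑ p ∈ Finset.HasAntidiagonal.antidiagonal k, b.multichoose p.2 = (b + 1).multichoose k := by
  rw [Finset.Nat.sum_antidiagonal_eq_sum_range_succ_mk]
  have h := Finset.sum_range_reflect b.multichoose (k + 1)
  simp only [Nat.add_sub_cancel] at h
  rw [h]
  clear h
  induction k with
  | zero => simp
  | succ k ih => rw [Finset.sum_range_succ, ih, multichoose_succ_succ, add_comm]

theorem coeff_powerSeries_mk_one_pow (b k : ℕ) :
    PowerSeries.coeff k ((PowerSeries.mk fun _ => (1 : ℕ)) ^ b) = b.multichoose k := by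
  induction b generalizing k with
  | zero => cases k <;> simp [PowerSeries.coeff_one]
  | succ b ih =>
    rw [_root_.pow_succ', PowerSeries.coeff_mul, ← sum_antidiagonal_multichoose]
    simp [ih]

/-- Vandermonde's identity for multiset coefficients. -/
theorem add_multichoose (b c k : ℕ) :
    (b + c).multichoose k =
      ∑ p ∈ Finset.HasAntidiagonal.antidiagonal k, b.multichoose p.1 * c.multichoose p.2 := by
  simp only [← coeff_powerSeries_mk_one_pow, pow_add, PowerSeries.coeff_mul]

end Nat

namespace YoungDiagram

theorem card_eq_sum_rowLen (μ : YoungDiagram) {n : ℕ} (hn : μ.rowLen n = 0) :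
    μ.card = ∑ i ∈ Finset.range n, μ.rowLen i := by
  rw [YoungDiagram.card, Finset.card_eq_sum_card_fiberwise (f := Prod.fst) (t := Finset.range n)]
  · exact Finset.sum_congr rfl fun i _ => (μ.rowLen_eq_card).symm
  · rintro ⟨i, j⟩ h
    have h' : j < μ.rowLen i := mem_iff_lt_rowLen.1 h
    simp only [Finset.coe_range, Set.mem_Iio]
    by_contra! hi
    have := μ.rowLen_anti n i hi
    omega

theorem rowLen_colLen_zero (μ : YoungDiagram) : μ.rowLen (μ.colLen 0) = 0 := by
  by_contra h
  have h' : (μ.colLen 0, 0) ∈ μ := mem_iff_lt_rowLen.2 (Nat.pos_of_ne_zero h)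
  exact lt_irrefl _ (mem_iff_lt_colLen.1 h')

theorem ext_rowLen {μ ν : YoungDiagram} (h : ∀ i, μ.rowLen i = ν.rowLen i) : μ = ν := by
  ext ⟨i, j⟩
  simp [mem_iff_lt_rowLen, h]

open Classical in
/-- The Young diagram whose `i`-th row has length `f i`, for `f` antitone and eventually zero
(and the empty diagram for any other `f`). -/
noncomputable def ofRowLenFun (f : ℕ → ℕ) : YoungDiagram :=
  if h : Antitone f ∧ ∃ n, f n = 0 then
    { cells := (Finset.range h.2.choose ×ˢ Finset.range (f 0)).filter fun c => c.2 < f c.1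
      isLowerSet := by
        rintro ⟨i, j⟩ ⟨i', j'⟩ ⟨hi, hj⟩ hc
        simp only [Finset.coe_filter, Finset.mem_product, Finset.mem_range,
          Set.mem_ofPred_eq] at hc hi hj ⊢
        have := h.1 hi
        omega }
  else ⊥

theorem rowLen_ofRowLenFun {f : ℕ → ℕ} (hf : Antitone f) {n : ℕ} (hn : f n = 0) (i : ℕ) :
    (ofRowLenFun f).rowLen i = f i := by
  have h : Antitone f ∧ ∃ n, f n = 0 := ⟨hf, n, hn⟩
  refine eq_of_forall_lt_iff fun j => ?_
  rw [← mem_iff_lt_rowLen, ofRowLenFun, dif_pos h]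
  change (i, j) ∈ Finset.filter _ _ ↔ _
  simp only [Finset.mem_filter, Finset.mem_product, Finset.mem_range, and_iff_right_iff_imp]
  intro hj
  refine ⟨?_, hj.trans_le (hf (Nat.zero_le i))⟩
  by_contra! hi
  have := hf hi
  have := h.2.choose_spec
  omega

theorem cells_injective : Function.Injective YoungDiagram.cells := fun _ _ => YoungDiagram.ext

theorem finite_setOf_le (μ : YoungDiagram) : {κ : YoungDiagram | κ ≤ μ}.Finite :=
  (μ.cells.powerset.finite_toSet.preimage cells_injective.injOn).subset fun κ hκ => by
    simpa using cells_subset_iff.2 hκ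

theorem finite_setOf_card_eq (n : ℕ) : {μ : YoungDiagram | μ.card = n}.Finite := by
  refine (((Finset.range n ×ˢ Finset.range n).powerset.finite_toSet).preimage
    cells_injective.injOn).subset ?_
  rintro μ rfl
  simp only [Set.mem_preimage, Finset.mem_coe, Finset.mem_powerset]
  rintro ⟨i, j⟩ h
  have h₁ : j < μ.rowLen i := mem_iff_lt_rowLen.1 h
  have h₂ : i < μ.colLen j := mem_iff_lt_colLen.1 h
  rw [rowLen_eq_card] at h₁
  rw [colLen_eq_card] at h₂
  simp only [Finset.mem_product, Finset.mem_range]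
  exact ⟨h₂.trans_le (Finset.card_le_card (Finset.filter_subset _ _)),
    h₁.trans_le (Finset.card_le_card (Finset.filter_subset _ _))⟩

/-- The Young diagrams with `n` boxes. -/
noncomputable def ofCard (n : ℕ) : Finset YoungDiagram := (finite_setOf_card_eq n).toFinset

@[simp]
theorem mem_ofCard {n : ℕ} {μ : YoungDiagram} : μ ∈ ofCard n ↔ μ.card = n := by
  simp [ofCard]

/-- `κ.Interlaces μ` says that `μ / κ` is a horizontal strip: `κ` is contained in `μ`, and no two
boxes of `μ` outside `κ` lie in the same column. -/
def Interlaces (κ μ : YoungDiagram) : Prop :=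
  κ ≤ μ ∧ ∀ ⦃i j : ℕ⦄, (i + 1, j) ∈ μ → (i, j) ∈ κ

theorem interlaces_iff_rowLen {κ μ : YoungDiagram} :
    κ.Interlaces μ ↔ ∀ i, κ.rowLen i ≤ μ.rowLen i ∧ μ.rowLen (i + 1) ≤ κ.rowLen i := by
  constructor
  · rintro ⟨h₁, h₂⟩ i
    refine ⟨le_of_forall_lt fun j hj => ?_, le_of_forall_lt fun j hj => ?_⟩
    · exact mem_iff_lt_rowLen.1 (h₁ (mem_iff_lt_rowLen.2 hj))
    · exact mem_iff_lt_rowLen.1 (h₂ (mem_iff_lt_rowLen.2 hj))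
  · intro h
    refine ⟨?_, fun i j hj => ?_⟩
    · rintro ⟨i, j⟩ hj
      exact mem_iff_lt_rowLen.2 ((mem_iff_lt_rowLen.1 hj).trans_le (h i).1)
    · exact mem_iff_lt_rowLen.2 ((mem_iff_lt_rowLen.1 hj).trans_le (h i).2)

/-- The diagrams obtained from `μ` by removing a horizontal strip. -/
noncomputable def lowerStrips (μ : YoungDiagram) : Finset YoungDiagram :=
  ((finite_setOf_le μ).subset fun _ h => And.left h : {κ | Interlaces κ μ}.Finite).toFinset

open Classical in
/-- The diagrams obtained from `κ` by adding a horizontal strip with `k` boxes. -/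
noncomputable def upperStrips (κ : YoungDiagram) (k : ℕ) : Finset YoungDiagram :=
  (ofCard (κ.card + k)).filter fun μ => κ.Interlaces μ

@[simp]
theorem mem_lowerStrips {κ μ : YoungDiagram} : κ ∈ μ.lowerStrips ↔ κ.Interlaces μ := by
  simp [lowerStrips]

@[simp]
theorem mem_upperStrips {κ μ : YoungDiagram} {k : ℕ} :
    μ ∈ κ.upperStrips k ↔ μ.card = κ.card + k ∧ κ.Interlaces μ := by
  simp [upperStrips]

/-! ### The local rule of the Robinson–Schensted–Knuth correspondence -/

/-- The local rule on a diagram `σ` that is interlaced by `μ` and `ν`. -/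
noncomputable def shrink (μ ν σ : YoungDiagram) : YoungDiagram :=
  ofRowLenFun fun i => max (μ.rowLen (i + 1)) (ν.rowLen (i + 1)) +
    min (μ.rowLen i) (ν.rowLen i) - σ.rowLen (i + 1)

/-- The inverse local rule on a diagram `κ` that interlaces `μ` and `ν`. -/
noncomputable def grow (μ ν κ : YoungDiagram) (k : ℕ) : YoungDiagram :=
  ofRowLenFun fun
    | 0 => max (μ.rowLen 0) (ν.rowLen 0) + k
    | i + 1 => max (μ.rowLen (i + 1)) (ν.rowLen (i + 1)) +
        min (μ.rowLen i) (ν.rowLen i) - κ.rowLen i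

theorem rowLen_shrink {μ ν σ : YoungDiagram} (hμ : μ.Interlaces σ) (hν : ν.Interlaces σ) (i : ℕ) :
    (shrink μ ν σ).rowLen i = max (μ.rowLen (i + 1)) (ν.rowLen (i + 1)) +
      min (μ.rowLen i) (ν.rowLen i) - σ.rowLen (i + 1) := by
  rw [interlaces_iff_rowLen] at hμ hν
  refine rowLen_ofRowLenFun (antitone_nat_of_succ_le fun i => ?_) (n := μ.colLen 0) ?_ i
  · have := hμ i
    have := hν i
    have := hμ (i + 1)
    have := hν (i + 1)
    have := hμ (i + 2)
    have := hν (i + 2)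
    grind
  · have := μ.rowLen_colLen_zero
    have := hμ (μ.colLen 0)
    have := hν (μ.colLen 0 + 1)
    have := hμ (μ.colLen 0 + 1)
    grind

theorem rowLen_grow {μ ν κ : YoungDiagram} (hμ : κ.Interlaces μ) (hν : κ.Interlaces ν) (k i : ℕ) :
    (grow μ ν κ k).rowLen i = match i with
      | 0 => max (μ.rowLen 0) (ν.rowLen 0) + k
      | i + 1 => max (μ.rowLen (i + 1)) (ν.rowLen (i + 1)) +
          min (μ.rowLen i) (ν.rowLen i) - κ.rowLen i := by
  rw [interlaces_iff_rowLen] at hμ hν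
  refine rowLen_ofRowLenFun (antitone_nat_of_succ_le fun i => ?_) (n := κ.colLen 0 + 2) ?_ i
  · rcases i with _ | i
    · have := hμ 0
      have := hν 0
      grind
    · have := hμ i
      have := hν i
      have := hμ (i + 1)
      have := hν (i + 1)
      grind
  · have := κ.rowLen_colLen_zero
    have := hμ (κ.colLen 0)
    have := hν (κ.colLen 0)
    have := hμ (κ.colLen 0 + 1)
    have := hν (κ.colLen 0 + 1)
    grind

theorem shrink_interlaces {μ ν σ : YoungDiagram} (hμ : μ.Interlaces σ) (hν : ν.Interlaces σ) :
    (shrink μ ν σ).Interlaces μ ∧ (shrink μ ν σ).Interlaces ν := by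
  simp only [interlaces_iff_rowLen, rowLen_shrink hμ hν]
  rw [interlaces_iff_rowLen] at hμ hν
  constructor <;> intro i <;> have := hμ i <;> have := hν i <;> have := hμ (i + 1) <;>
    have := hν (i + 1) <;> grind

theorem interlaces_grow {μ ν κ : YoungDiagram} (hμ : κ.Interlaces μ) (hν : κ.Interlaces ν)
    (k : ℕ) : μ.Interlaces (grow μ ν κ k) ∧ ν.Interlaces (grow μ ν κ k) := by
  simp only [interlaces_iff_rowLen, rowLen_grow hμ hν]
  rw [interlaces_iff_rowLen] at hμ hν
  constructor <;> rintro (_ | i) <;> simp only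
  · have := hμ 0
    have := hν 0
    grind
  · have := hμ i
    have := hν i
    have := hμ (i + 1)
    have := hν (i + 1)
    grind
  · have := hμ 0
    have := hν 0
    grind
  · have := hμ i
    have := hν i
    have := hμ (i + 1)
    have := hν (i + 1)
    grind

theorem grow_shrink {μ ν σ : YoungDiagram} (hμ : μ.Interlaces σ) (hν : ν.Interlaces σ) :
    grow μ ν (shrink μ ν σ) (σ.rowLen 0 - max (μ.rowLen 0) (ν.rowLen 0)) = σ := by
  obtain ⟨h₁, h₂⟩ := shrink_interlaces hμ hν
  refine ext_rowLen fun i => ?_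
  rw [rowLen_grow h₁ h₂]
  rw [interlaces_iff_rowLen] at hμ hν
  rcases i with _ | i
  · have := hμ 0
    have := hν 0
    grind
  · simp only [rowLen_shrink (interlaces_iff_rowLen.2 hμ) (interlaces_iff_rowLen.2 hν)]
    have := hμ i
    have := hν i
    have := hμ (i + 1)
    have := hν (i + 1)
    grind

theorem shrink_grow {μ ν κ : YoungDiagram} (hμ : κ.Interlaces μ) (hν : κ.Interlaces ν) (k : ℕ) :
    shrink μ ν (grow μ ν κ k) = κ := by
  obtain ⟨h₁, h₂⟩ := interlaces_grow hμ hν k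
  refine ext_rowLen fun i => ?_
  rw [rowLen_shrink h₁ h₂, rowLen_grow hμ hν]
  rw [interlaces_iff_rowLen] at hμ hν
  have := hμ i
  have := hν i
  grind

theorem card_add_card_shrink {μ ν σ : YoungDiagram} (hμ : μ.Interlaces σ) (hν : ν.Interlaces σ) :
    σ.card + (shrink μ ν σ).card =
      μ.card + ν.card + (σ.rowLen 0 - max (μ.rowLen 0) (ν.rowLen 0)) := by
  have hr := rowLen_shrink hμ hν
  obtain ⟨h₁, h₂⟩ := shrink_interlaces hμ hν
  rw [interlaces_iff_rowLen] at hμ hν h₁ h₂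
  obtain ⟨n, hμn, hνn⟩ : ∃ n, μ.rowLen n = 0 ∧ ν.rowLen n = 0 := by
    refine ⟨max (μ.colLen 0) (ν.colLen 0), ?_, ?_⟩
    · have := μ.rowLen_anti _ _ (le_max_left (μ.colLen 0) (ν.colLen 0))
      rw [rowLen_colLen_zero] at this
      omega
    · have := ν.rowLen_anti _ _ (le_max_right (μ.colLen 0) (ν.colLen 0))
      rw [rowLen_colLen_zero] at this
      omega
  have hσn : σ.rowLen (n + 1) = 0 := by have := hμ n; omega
  have hκn : (shrink μ ν σ).rowLen n = 0 := by have := h₁ n; omega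
  have hmax : ∑ i ∈ Finset.range n, max (μ.rowLen (i + 1)) (ν.rowLen (i + 1)) +
      max (μ.rowLen 0) (ν.rowLen 0) = ∑ i ∈ Finset.range n, max (μ.rowLen i) (ν.rowLen i) := by
    rw [← Finset.sum_range_succ' (fun i => max (μ.rowLen i) (ν.rowLen i)), Finset.sum_range_succ]
    simp [hμn, hνn]
  have hsum : ∑ i ∈ Finset.range n, max (μ.rowLen i) (ν.rowLen i) +
      ∑ i ∈ Finset.range n, min (μ.rowLen i) (ν.rowLen i) =
      ∑ i ∈ Finset.range n, μ.rowLen i + ∑ i ∈ Finset.range n, ν.rowLen i := by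
    simp only [← Finset.sum_add_distrib, max_add_min]
  have hflip : ∑ i ∈ Finset.range n, σ.rowLen (i + 1) +
      ∑ i ∈ Finset.range n, (shrink μ ν σ).rowLen i =
      ∑ i ∈ Finset.range n, max (μ.rowLen (i + 1)) (ν.rowLen (i + 1)) +
        ∑ i ∈ Finset.range n, min (μ.rowLen i) (ν.rowLen i) := by
    simp only [← Finset.sum_add_distrib]
    refine Finset.sum_congr rfl fun i _ => ?_
    rw [hr]
    have := hμ i
    have := hν i
    grind
  rw [card_eq_sum_rowLen σ hσn, card_eq_sum_rowLen _ hκn, card_eq_sum_rowLen μ hμn,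
    card_eq_sum_rowLen ν hνn, Finset.sum_range_succ']
  have := max_le (hμ 0).1 (hν 0).1
  omega

/-- Adding a strip and then removing one is the same as removing a strip and then adding one, up to
the extra boxes that the local rule creates in the first row. -/
theorem sum_upperStrips_sum_lowerStrips (f : YoungDiagram → ℕ) (μ : YoungDiagram) (k : ℕ) :
    ∑ σ ∈ μ.upperStrips k, ∑ ν ∈ σ.lowerStrips, f ν =
      ∑ p ∈ Finset.HasAntidiagonal.antidiagonal k, ∑ κ ∈ μ.lowerStrips,
        ∑ ν ∈ κ.upperStrips p.2, f ν := by
  simp only [Finset.sum_sigma']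
  refine Finset.sum_bij'
    (fun x _ => ⟨(x.1.rowLen 0 - max (μ.rowLen 0) (x.2.rowLen 0),
      x.2.card - (shrink μ x.2 x.1).card), shrink μ x.2 x.1, x.2⟩)
    (fun y _ => ⟨grow μ y.2.2 y.2.1 y.1.1, y.2.2⟩) ?_ ?_ ?_ ?_ ?_
  · rintro ⟨σ, ν⟩ h
    simp only [Finset.mem_sigma, mem_upperStrips, mem_lowerStrips,
      Finset.HasAntidiagonal.mem_antidiagonal] at h ⊢
    obtain ⟨⟨hk, hμ⟩, hν⟩ := h
    obtain ⟨h₁, h₂⟩ := shrink_interlaces hμ hν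
    have hcard := card_add_card_shrink hμ hν
    have hle : (shrink μ ν σ).card ≤ ν.card := Finset.card_le_card h₂.1
    exact ⟨by omega, h₁, by omega, h₂⟩
  · rintro ⟨⟨j, m⟩, κ, ν⟩ h
    simp only [Finset.mem_sigma, mem_upperStrips, mem_lowerStrips,
      Finset.HasAntidiagonal.mem_antidiagonal] at h ⊢
    obtain ⟨hk, hμ, hm, hν⟩ := h
    obtain ⟨h₁, h₂⟩ := interlaces_grow hμ hν j
    have hcard := card_add_card_shrink h₁ h₂
    rw [shrink_grow hμ hν, rowLen_grow hμ hν] at hcard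
    exact ⟨⟨by grind, h₁⟩, h₂⟩
  · rintro ⟨σ, ν⟩ h
    simp only [Finset.mem_sigma, mem_upperStrips, mem_lowerStrips] at h
    simp only [grow_shrink h.1.2 h.2]
  · rintro ⟨⟨j, m⟩, κ, ν⟩ h
    simp only [Finset.mem_sigma, mem_upperStrips, mem_lowerStrips,
      Finset.HasAntidiagonal.mem_antidiagonal] at h
    obtain ⟨hk, hμ, hm, hν⟩ := h
    simp [shrink_grow hμ hν, rowLen_grow hμ hν, hm]
  · intros
    rfl

/-! ### Counting semistandard tableaux by branching -/

open Classical in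
/-- The number of semistandard Young tableaux of shape `μ` with entries less than `b`, defined
by the branching rule. -/
noncomputable def branchCount : ℕ → YoungDiagram → ℕ
  | 0, μ => if μ = ⊥ then 1 else 0
  | b + 1, μ => ∑ κ ∈ μ.lowerStrips, branchCount b κ

theorem eq_bot_of_interlaces_bot {κ : YoungDiagram} (h : κ.Interlaces ⊥) : κ = ⊥ :=
  le_bot_iff.1 h.1

theorem bot_interlaces_bot : (⊥ : YoungDiagram).Interlaces ⊥ :=
  ⟨le_rfl, fun _ _ h => absurd h (notMem_bot _)⟩

theorem colLen_zero_le_of_branchCount_ne_zero {b : ℕ} {μ : YoungDiagram}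
    (h : branchCount b μ ≠ 0) : μ.colLen 0 ≤ b := by
  suffices h' : (b, 0) ∉ μ by
    rw [mem_iff_lt_colLen] at h'
    omega
  induction b generalizing μ with
  | zero =>
    obtain rfl : μ = ⊥ := by
      by_contra hμ
      simp [branchCount, hμ] at h
    exact notMem_bot _
  | succ b ih =>
    obtain ⟨κ, hκ, hne⟩ := Finset.exists_ne_zero_of_sum_ne_zero h
    rw [mem_lowerStrips] at hκ
    exact fun hb => ih hne (hκ.2 hb)

/-- Pieri's rule, evaluated at `b` ones. -/
theorem sum_upperStrips_branchCount (b k : ℕ) (μ : YoungDiagram) :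
    ∑ σ ∈ μ.upperStrips k, branchCount b σ = b.multichoose k * branchCount b μ := by
  classical
  induction b generalizing k μ with
  | zero =>
    simp only [branchCount, Finset.sum_ite_eq', mem_upperStrips]
    by_cases hμ : μ = ⊥
    · subst hμ
      cases k <;> simp [bot_interlaces_bot, YoungDiagram.card]
    · have : ¬ μ.Interlaces ⊥ := fun h => hμ (eq_bot_of_interlaces_bot h)
      simp [hμ, this]
  | succ b ih =>
    simp only [branchCount]
    rw [sum_upperStrips_sum_lowerStrips]
    simp only [ih]
    simp only [← Finset.mul_sum]
    rw [← Finset.sum_mul, Nat.sum_antidiagonal_multichoose]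

/-- The degree `n` part of Cauchy's identity, evaluated at `a` and `b` ones. -/
theorem sum_branchCount_mul_branchCount (a b n : ℕ) :
    ∑ μ ∈ ofCard n, branchCount a μ * branchCount b μ = (a * b).multichoose n := by
  classical
  induction a generalizing n with
  | zero =>
    simp only [branchCount, ite_mul, one_mul, zero_mul, Finset.sum_ite_eq', mem_ofCard]
    rcases n with _ | n
    · have : branchCount b ⊥ = 1 := by
        induction b with
        | zero => simp [branchCount]
        | succ b ih =>
          have : (⊥ : YoungDiagram).lowerStrips = {⊥} := by
            ext κ
            simp only [mem_lowerStrips, Finset.mem_singleton]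
            exact ⟨eq_bot_of_interlaces_bot, fun h => h ▸ bot_interlaces_bot⟩
          simp [branchCount, this, ih]
      simp [this, YoungDiagram.card]
    · simp [YoungDiagram.card]
  | succ a ih =>
    have key : ∑ μ ∈ ofCard n, branchCount (a + 1) μ * branchCount b μ =
        ∑ p ∈ Finset.HasAntidiagonal.antidiagonal n, ∑ κ ∈ ofCard p.1, ∑ μ ∈ κ.upperStrips p.2,
          branchCount a κ * branchCount b μ := by
      simp only [branchCount, Finset.sum_mul, Finset.sum_sigma']
      refine Finset.sum_bij' (fun x _ => ⟨(x.2.card, n - x.2.card), x.2, x.1⟩)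
        (fun y _ => ⟨y.2.2, y.2.1⟩) ?_ ?_ ?_ ?_ ?_
      · rintro ⟨μ, κ⟩ h
        simp only [Finset.mem_sigma, mem_ofCard, mem_upperStrips, mem_lowerStrips,
          Finset.HasAntidiagonal.mem_antidiagonal] at h ⊢
        have hle : κ.card ≤ μ.card := Finset.card_le_card h.2.1
        exact ⟨by omega, trivial, by omega, h.2⟩
      · rintro ⟨⟨i, k⟩, κ, μ⟩ h
        simp only [Finset.mem_sigma, mem_ofCard, mem_upperStrips, mem_lowerStrips,
          Finset.HasAntidiagonal.mem_antidiagonal] at h ⊢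
        exact ⟨by omega, h.2.2.2⟩
      · intros
        rfl
      · rintro ⟨⟨i, k⟩, κ, μ⟩ h
        simp only [Finset.mem_sigma, mem_ofCard, Finset.HasAntidiagonal.mem_antidiagonal] at h
        obtain ⟨rfl, rfl, -⟩ := h
        simp
      · intros
        rfl
    rw [key, add_one_mul, Nat.add_multichoose]
    refine Finset.sum_congr rfl fun p _ => ?_
    simp only [← Finset.mul_sum, sum_upperStrips_branchCount]
    rw [← ih, Finset.sum_mul]
    exact Finset.sum_congr rfl fun κ _ => by ring

end YoungDiagram

namespace SemistandardYoungTableau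

open YoungDiagram

/-- The semistandard Young tableaux of shape `μ` with entries less than `d`. -/
abbrev Bounded (d : ℕ) (μ : YoungDiagram) : Type :=
  {T : SemistandardYoungTableau μ // ∀ i j : ℕ, (i, j) ∈ μ → T i j < d}

/-- The diagram formed by the boxes of `T` whose entry is less than `d`. -/
def shapeLT {μ : YoungDiagram} (T : SemistandardYoungTableau μ) (d : ℕ) : YoungDiagram where
  cells := μ.cells.filter fun c => T c.1 c.2 < d
  isLowerSet := by
    rintro ⟨i, j⟩ ⟨i', j'⟩ ⟨hi, hj⟩ hc
    simp only [Finset.coe_filter, mem_cells, Set.mem_ofPred_eq] at hc hi hj ⊢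
    have hi'j := μ.up_left_mem hi le_rfl hc.1
    exact ⟨μ.up_left_mem le_rfl hj hi'j,
      ((T.row_weak_of_le hj hi'j).trans (T.col_weak hi hc.1)).trans_lt hc.2⟩

theorem mem_shapeLT {μ : YoungDiagram} {T : SemistandardYoungTableau μ} {d i j : ℕ} :
    (i, j) ∈ T.shapeLT d ↔ (i, j) ∈ μ ∧ T i j < d := by
  change (i, j) ∈ Finset.filter _ _ ↔ _
  simp

theorem shapeLT_interlaces {d : ℕ} {μ : YoungDiagram} (T : Bounded (d + 1) μ) :
    (T.1.shapeLT d).Interlaces μ := by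
  refine ⟨fun c hc => (mem_shapeLT.1 hc).1, fun i j h => mem_shapeLT.2 ?_⟩
  have := T.1.col_strict (Nat.lt_add_one i) h
  have := T.2 _ _ h
  exact ⟨μ.up_left_mem i.le_succ le_rfl h, by omega⟩

/-- The restriction of `T` to the boxes whose entry is less than `d`. -/
def restrictLT {μ : YoungDiagram} (T : SemistandardYoungTableau μ) (d : ℕ) :
    Bounded d (T.shapeLT d) where
  val :=
    { entry := fun i j => if (i, j) ∈ T.shapeLT d then T i j else 0
      row_weak' := fun hj h => by
        rw [if_pos h, if_pos (up_left_mem _ le_rfl hj.le h)]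
        exact T.row_weak hj (mem_shapeLT.1 h).1
      col_strict' := fun hi h => by
        rw [if_pos h, if_pos (up_left_mem _ hi.le le_rfl h)]
        exact T.col_strict hi (mem_shapeLT.1 h).1
      zeros' := fun h => if_neg h }
  property i j h := (if_pos h).trans_lt (mem_shapeLT.1 h).2

/-- Extend a tableau with entries less than `d` along a horizontal strip, filled with `d`. -/
def extend {d : ℕ} {κ μ : YoungDiagram} (h : κ.Interlaces μ) (T : Bounded d κ) :
    Bounded (d + 1) μ where
  val :=
    { entry := fun i j => if (i, j) ∈ κ then T.1 i j else if (i, j) ∈ μ then d else 0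
      row_weak' := fun {i j₁ j₂} hj hμ => by
        by_cases hκ : (i, j₂) ∈ κ
        · rw [if_pos hκ, if_pos (up_left_mem _ le_rfl hj.le hκ)]
          exact T.1.row_weak hj hκ
        · rw [if_neg hκ, if_pos hμ]
          split_ifs with h₁ h₂
          · exact (T.2 _ _ h₁).le
          · exact le_rfl
          · exact Nat.zero_le _
      col_strict' := fun {i₁ i₂ j} hi hμ => by
        have hκ₁ : (i₁, j) ∈ κ := h.2 (up_left_mem _ hi le_rfl hμ)
        rw [if_pos hκ₁]
        by_cases hκ : (i₂, j) ∈ κ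
        · rw [if_pos hκ]
          exact T.1.col_strict hi hκ
        · rw [if_neg hκ, if_pos hμ]
          exact T.2 _ _ hκ₁
      zeros' := fun hμ => by rw [if_neg fun hκ => hμ (h.1 hκ), if_neg hμ] }
  property i j hμ := by
    change (if (i, j) ∈ κ then T.1 i j else if (i, j) ∈ μ then d else 0) < d + 1
    split_ifs with h₁
    · exact (T.2 _ _ h₁).trans d.lt_succ_self
    · exact d.lt_succ_self

theorem extend_apply {d : ℕ} {κ μ : YoungDiagram} (h : κ.Interlaces μ) (T : Bounded d κ)
    (i j : ℕ) : (extend h T).1 i j =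
      if (i, j) ∈ κ then T.1 i j else if (i, j) ∈ μ then d else 0 := rfl

theorem restrictLT_apply {μ : YoungDiagram} (T : SemistandardYoungTableau μ) (d i j : ℕ) :
    (T.restrictLT d).1 i j = if (i, j) ∈ T.shapeLT d then T i j else 0 := rfl

theorem shapeLT_extend {d : ℕ} {κ μ : YoungDiagram} (h : κ.Interlaces μ) (T : Bounded d κ) :
    (extend h T).1.shapeLT d = κ := by
  refine SetLike.ext ?_
  rintro ⟨i, j⟩
  rw [mem_shapeLT, extend_apply]
  constructor
  · rintro ⟨hμ, hd⟩
    by_contra hκ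
    simp [hκ, hμ] at hd
  · intro hκ
    exact ⟨h.1 hκ, by simpa [hκ] using T.2 _ _ hκ⟩

theorem extend_restrictLT {d : ℕ} {μ : YoungDiagram} (T : Bounded (d + 1) μ) :
    extend (shapeLT_interlaces T) (T.1.restrictLT d) = T := by
  refine Subtype.ext (SemistandardYoungTableau.ext fun i j => ?_)
  rw [extend_apply, restrictLT_apply]
  by_cases hμ : (i, j) ∈ μ
  · have := T.2 _ _ hμ
    simp only [mem_shapeLT, hμ, true_and, if_true]
    split_ifs <;> omega
  · simp [mem_shapeLT, hμ, T.1.zeros hμ]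

theorem Bounded.ext_sigma {d : ℕ} {μ : YoungDiagram}
    {x y : Σ κ : {κ : YoungDiagram // κ ∈ μ.lowerStrips}, Bounded d κ.1}
    (h₁ : x.1.1 = y.1.1) (h₂ : ∀ i j, x.2.1 i j = y.2.1 i j) : x = y := by
  obtain ⟨⟨κ, hκ⟩, T⟩ := x
  obtain ⟨⟨κ', hκ'⟩, T'⟩ := y
  obtain rfl : κ = κ' := h₁
  obtain rfl : T = T' := Subtype.ext (SemistandardYoungTableau.ext h₂)
  rfl

/-- The branching rule: a tableau with entries less than `d + 1` is a tableau with entries less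
than `d` together with a horizontal strip. -/
def branchEquiv (d : ℕ) (μ : YoungDiagram) :
    Bounded (d + 1) μ ≃ Σ κ : {κ : YoungDiagram // κ ∈ μ.lowerStrips}, Bounded d κ.1 where
  toFun T := ⟨⟨T.1.shapeLT d, mem_lowerStrips.2 (shapeLT_interlaces T)⟩, T.1.restrictLT d⟩
  invFun x := extend (mem_lowerStrips.1 x.1.2) x.2
  left_inv T := extend_restrictLT T
  right_inv x := by
    have h := mem_lowerStrips.1 x.1.2
    refine Bounded.ext_sigma (shapeLT_extend h x.2) fun i j => ?_
    simp only [restrictLT_apply, shapeLT_extend, extend_apply]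
    split_ifs with hκ
    · rfl
    · exact (x.2.1.zeros hκ).symm

theorem finite_bounded_and_card_eq (d : ℕ) (μ : YoungDiagram) :
    Finite (Bounded d μ) ∧ Nat.card (Bounded d μ) = branchCount d μ := by
  induction d generalizing μ with
  | zero =>
    by_cases hμ : μ = ⊥
    · subst hμ
      have : Unique (Bounded 0 (⊥ : YoungDiagram)) :=
        { default := ⟨highestWeight ⊥, fun _ _ h => absurd h (notMem_bot _)⟩
          uniq := fun T => Subtype.ext <| SemistandardYoungTableau.ext fun i j => by
            rw [T.1.zeros (notMem_bot _), zeros _ (notMem_bot _)] }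
      exact ⟨inferInstance, by simp [branchCount]⟩
    · have : IsEmpty (Bounded 0 μ) := by
        refine ⟨fun T => hμ (SetLike.ext ?_)⟩
        rintro ⟨i, j⟩
        exact ⟨fun h => absurd (T.2 i j h) (Nat.not_lt_zero _), fun h => absurd h (notMem_bot _)⟩
      exact ⟨inferInstance, by simp [branchCount, hμ]⟩
  | succ d ih =>
    have : ∀ κ, Finite (Bounded d κ) := fun κ => (ih κ).1
    refine ⟨Finite.of_equiv _ (branchEquiv d μ).symm, ?_⟩
    rw [Nat.card_congr (branchEquiv d μ), Nat.card_sigma, branchCount]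
    simp only [(ih _).2]
    exact Finset.sum_coe_sort μ.lowerStrips (branchCount d)

end SemistandardYoungTableau

/-- For `d ≥ 1` and any `Q`, the sum over Young diagrams `μ` with `Q` boxes
and at most `d` rows of the squared number of semistandard Young tableaux of shape `μ` with
entries in `{0, …, d−1}` equals the binomial coefficient `C(Q + d² − 1, Q)`. -/
theorem sum_sq_dim_eq_choose (d Q : ℕ) (hd : 1 ≤ d) :
    ∑ᶠ μ ∈ {μ : YoungDiagram | μ.card = Q ∧ μ.colLen 0 ≤ d},
        (Nat.card {T : SemistandardYoungTableau μ // ∀ i j : ℕ, (i, j) ∈ μ → T i j < d}) ^ 2 =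
      (Q + d ^ 2 - 1).choose Q := by
  have hcard (μ : YoungDiagram) : Nat.card (SemistandardYoungTableau.Bounded d μ) =
      YoungDiagram.branchCount d μ := (SemistandardYoungTableau.finite_bounded_and_card_eq d μ).2
  simp only [hcard]
  rw [finsum_mem_eq_sum_of_inter_support_eq (s := {μ | μ.card = Q ∧ μ.colLen 0 ≤ d})
    (t := YoungDiagram.ofCard Q)]
  · simp only [sq, YoungDiagram.sum_branchCount_mul_branchCount, Nat.multichoose_eq]
    rw [add_comm]
  · ext μ
    simp only [Set.mem_inter_iff, Set.mem_ofPred_eq, Function.mem_support, Finset.mem_coe,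
      YoungDiagram.mem_ofCard, and_congr_left_iff, and_iff_left_iff_imp]
    exact fun h _ => YoungDiagram.colLen_zero_le_of_branchCount_ne_zero
      (pow_ne_zero_iff two_ne_zero |>.1 h)
end
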